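/- For every integer k ≥ 0 there exist constants a_k, d_k > 0 such that for every n ≥ 2 there is a total Boolean function f : {0,1}^{N} → {0,1} with N ≤ a_k · n^(25^k), D(f) ≥ n^(2k+1) / (a_k · (log₂ n)^{d_k}), and UC(f) ≤ a_k · n^(k+1) · (log₂ n)^{d_k}. -/

import Mathlib

/-! ### Partial assignments and certificate complexity -/

/-- An input `x` is consistent with a partial assignment `p` if it agrees with
`p` wherever `p` is defined. -/
def Consistent {n : ℕ} (x : Fin n → Bool) (p : Fin n → Option Bool) : Prop :=
  ∀ i : Fin n, ∀ b : Bool, p i = some b → x i = b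

instance {n : ℕ} (x : Fin n → Bool) (p : Fin n → Option Bool) :
    Decidable (Consistent x p) := by unfold Consistent; infer_instance

/-- The width of a partial assignment: the number of fixed coordinates. -/
def paWidth {n : ℕ} (p : Fin n → Option Bool) : ℕ :=
  (Finset.univ.filter (fun i : Fin n => (p i).isSome)).card

/-- `p` is a `b`-certificate for `f`: every input consistent with `p` has value `b`. -/
def IsCert {n : ℕ} (f : (Fin n → Bool) → Bool) (b : Bool) (p : Fin n → Option Bool) : Prop :=
  ∀ x : Fin n → Bool, Consistent x p → f x = b

instance {n : ℕ} (f : (Fin n → Bool) → Bool) (b : Bool) (p : Fin n → Option Bool) :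
    Decidable (IsCert f b p) := by unfold IsCert; infer_instance

/-- The `b`-certificate complexity `C_b(f)`. -/
noncomputable def certC {n : ℕ} (f : (Fin n → Bool) → Bool) (b : Bool) : ℕ :=
  sInf {w : ℕ | ∀ x : Fin n → Bool, f x = b →
    ∃ p : Fin n → Option Bool, IsCert f b p ∧ paWidth p ≤ w ∧ Consistent x p}

/-- The certificate complexity `C(f) = max{C_0(f), C_1(f)}`. -/
noncomputable def certCC {n : ℕ} (f : (Fin n → Bool) → Bool) : ℕ :=
  max (certC f false) (certC f true)

/-- The unambiguous `b`-certificate complexity `UC_b(f)`. -/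
noncomputable def UCb {n : ℕ} (f : (Fin n → Bool) → Bool) (b : Bool) : ℕ :=
  sInf {w : ℕ | ∃ S : Set (Fin n → Option Bool),
    (∀ p ∈ S, IsCert f b p ∧ paWidth p ≤ w) ∧
    ∀ x : Fin n → Bool, f x = b → ∃! p, p ∈ S ∧ Consistent x p}

/-- Subcube partition complexity `UC(f) = max{UC_0(f), UC_1(f)}`. -/
noncomputable def UC {n : ℕ} (f : (Fin n → Bool) → Bool) : ℕ :=
  max (UCb f false) (UCb f true)

/-! ### Decision trees, deterministic and randomized query complexity -/

/-- Deterministic decision trees on `n` bits. -/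
inductive DT (n : ℕ) where
  | leaf : Bool → DT n
  | node : Fin n → DT n → DT n → DT n

/-- Evaluation of a decision tree on an input. -/
def DT.eval {n : ℕ} : DT n → (Fin n → Bool) → Bool
  | .leaf b, _ => b
  | .node i t0 t1, x => if x i then t1.eval x else t0.eval x

/-- Depth of a decision tree. -/
def DT.depth {n : ℕ} : DT n → ℕ
  | .leaf _ => 0
  | .node _ t0 t1 => 1 + max t0.depth t1.depth

/-- Deterministic query complexity `D(f)`. -/
noncomputable def Dquery {n : ℕ} (f : (Fin n → Bool) → Bool) : ℕ :=
  sInf {d : ℕ | ∃ T : DT n, T.depth ≤ d ∧ ∀ x, T.eval x = f x}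

/-! ### Query sets over arbitrary index types -/

section QuerySets

variable {ι J κ : Type}

/-- `f` takes a single value on the inputs that agree with `x` on `S`. -/
def Fixes (f : (ι → Bool) → Bool) (S : Finset ι) (x : ι → Bool) : Prop :=
  ∀ x', (∀ i ∈ S, x' i = x i) → f x' = f x

/-- Every input has a certificate, with at most `w b` queries for inputs of value `b`. -/
def HasCert (f : (ι → Bool) → Bool) (w : Bool → ℕ) : Prop :=
  ∃ Q : (ι → Bool) → Finset ι, ∀ x, (Q x).card ≤ w (f x) ∧ Fixes f (Q x) x

/-- Every input has an unambiguous certificate, with at most `w b` queries for inputs of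
value `b`: the query set of an input is determined by the values queried. -/
def HasUnambCert (f : (ι → Bool) → Bool) (w : Bool → ℕ) : Prop :=
  ∃ Q : (ι → Bool) → Finset ι, ∀ x, (Q x).card ≤ w (f x) ∧
    ∀ x', (∀ i ∈ Q x, x' i = x i) → f x' = f x ∧ Q x' = Q x

/-- An adversary can force at least `d` queries on the inputs in `A`. -/
def Hard (f : (ι → Bool) → Bool) : Set (ι → Bool) → ℕ → Prop
  | _, 0 => True
  | A, d + 1 => (∀ b, ∃ x ∈ A, f x = b) ∧ ∀ i, ∃ b, Hard f {x ∈ A | x i = b} d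

theorem Fixes.congr {f : (ι → Bool) → Bool} {S : Finset ι} {x y : ι → Bool}
    (h : Fixes f S x) (hxy : ∀ i ∈ S, y i = x i) : Fixes f S y := by
  intro z hz
  rw [h y hxy]
  exact h z fun i hi => (hz i hi).trans (hxy i hi)

theorem fixes_congr {f : (ι → Bool) → Bool} {S : Finset ι} {x y : ι → Bool}
    (hxy : ∀ i ∈ S, y i = x i) : Fixes f S y ↔ Fixes f S x :=
  ⟨fun h => h.congr fun i hi => (hxy i hi).symm, fun h => h.congr hxy⟩

theorem HasCert.mono {f : (ι → Bool) → Bool} {w w' : Bool → ℕ} (h : HasCert f w)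
    (hw : ∀ b, w b ≤ w' b) : HasCert f w' := by
  obtain ⟨Q, hQ⟩ := h
  exact ⟨Q, fun x => ⟨(hQ x).1.trans (hw _), (hQ x).2⟩⟩

theorem HasUnambCert.mono {f : (ι → Bool) → Bool} {w w' : Bool → ℕ} (h : HasUnambCert f w)
    (hw : ∀ b, w b ≤ w' b) : HasUnambCert f w' := by
  obtain ⟨Q, hQ⟩ := h
  exact ⟨Q, fun x => ⟨(hQ x).1.trans (hw _), (hQ x).2⟩⟩

theorem HasUnambCert.hasCert {f : (ι → Bool) → Bool} {w : Bool → ℕ} (h : HasUnambCert f w) :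
    HasCert f w := by
  obtain ⟨Q, hQ⟩ := h
  exact ⟨Q, fun x => ⟨(hQ x).1, fun x' hx' => ((hQ x).2 x' hx').1⟩⟩

theorem HasCert.not {f : (ι → Bool) → Bool} {w : Bool → ℕ} (h : HasCert f w) :
    HasCert (fun x => !f x) (fun b => w !b) := by
  obtain ⟨Q, hQ⟩ := h
  refine ⟨Q, fun x => ⟨by simpa using (hQ x).1, fun x' hx' => ?_⟩⟩
  simpa using (hQ x).2 x' hx'

theorem HasUnambCert.not {f : (ι → Bool) → Bool} {w : Bool → ℕ} (h : HasUnambCert f w) :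
    HasUnambCert (fun x => !f x) (fun b => w !b) := by
  obtain ⟨Q, hQ⟩ := h
  refine ⟨Q, fun x => ⟨by simpa using (hQ x).1, fun x' hx' => ?_⟩⟩
  simpa using (hQ x).2 x' hx'

theorem Hard.mono {f : (ι → Bool) → Bool} {A B : Set (ι → Bool)} {d : ℕ} (h : Hard f A d)
    (hAB : A ⊆ B) : Hard f B d := by
  induction d generalizing A B with
  | zero => trivial
  | succ d ih =>
    refine ⟨fun b => ?_, fun i => ?_⟩
    · obtain ⟨x, hx, hb⟩ := h.1 b
      exact ⟨x, hAB hx, hb⟩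
    · obtain ⟨b, hb⟩ := h.2 i
      exact ⟨b, ih hb fun x hx => ⟨hAB hx.1, hx.2⟩⟩

theorem Hard.of_succ {f : (ι → Bool) → Bool} {A : Set (ι → Bool)} {d : ℕ}
    (h : Hard f A (d + 1)) : Hard f A d := by
  induction d generalizing A with
  | zero => trivial
  | succ d ih =>
    refine ⟨h.1, fun i => ?_⟩
    obtain ⟨b, hb⟩ := h.2 i
    exact ⟨b, ih hb⟩

theorem Hard.not {f : (ι → Bool) → Bool} {A : Set (ι → Bool)} {d : ℕ} (h : Hard f A d) :
    Hard (fun x => !f x) A d := by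
  induction d generalizing A with
  | zero => trivial
  | succ d ih =>
    refine ⟨fun b => ?_, fun i => ?_⟩
    · obtain ⟨x, hx, hb⟩ := h.1 (!b)
      exact ⟨x, hx, by simp [hb]⟩
    · obtain ⟨b, hb⟩ := h.2 i
      exact ⟨b, ih hb⟩

/-- The pairs `(j, i)` with `i ∈ T j`. -/
def slab [Fintype J] [DecidableEq J] [DecidableEq ι] (T : J → Finset ι) : Finset (J × ι) :=
  Finset.univ.biUnion fun j => (T j).map ⟨Prod.mk j, Prod.mk_right_injective j⟩

theorem mem_slab [Fintype J] [DecidableEq J] [DecidableEq ι] {T : J → Finset ι} {j : J} {i : ι} :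
    (j, i) ∈ slab T ↔ i ∈ T j := by
  simp [slab]

theorem card_slab_le [Fintype J] [DecidableEq J] [DecidableEq ι] (T : J → Finset ι) :
    (slab T).card ≤ ∑ j, (T j).card := by
  refine Finset.card_biUnion_le.trans (le_of_eq ?_)
  simp

end QuerySets

/-! ### Conjunctions of independent copies -/

section Conjunction

variable {ι : Type} {n : ℕ}

/-- The conjunction of `n` copies of `g` on disjoint inputs. -/
def andCopies (n : ℕ) (g : (ι → Bool) → Bool) (z : Fin n × ι → Bool) : Bool :=
  decide (∀ i, g (fun j => z (i, j)) = true)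

theorem andCopies_eq_false {g : (ι → Bool) → Bool} {z : Fin n × ι → Bool} :
    andCopies n g z = false ↔ ∃ i, g (fun j => z (i, j)) = false := by
  simp [andCopies]

theorem andCopies_eq_true {g : (ι → Bool) → Bool} {z : Fin n × ι → Bool} :
    andCopies n g z = true ↔ ∀ i, g (fun j => z (i, j)) = true := by
  simp [andCopies]

theorem HasCert.andCopies {g : (ι → Bool) → Bool} {w : Bool → ℕ} (h : HasCert g w) :
    HasCert (andCopies n g) (fun b => if b then n * w true else w false) := by
  classical
  obtain ⟨Q, hQ⟩ := h
  suffices H : ∀ z, ∃ S : Finset (Fin n × ι),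
      S.card ≤ (if _root_.andCopies n g z then n * w true else w false) ∧
        Fixes (_root_.andCopies n g) S z by
    choose S hS using H
    exact ⟨S, hS⟩
  intro z
  cases hz : _root_.andCopies n g z with
  | true =>
    have hz' := andCopies_eq_true.1 hz
    refine ⟨slab fun i => Q fun j => z (i, j), ?_, fun z' hz1 => ?_⟩
    · refine (card_slab_le _).trans ((Finset.sum_le_card_nsmul _ _ (w true) fun i _ => ?_).trans ?_)
      · simpa [hz' i] using (hQ fun j => z (i, j)).1
      · simp
    · rw [hz, andCopies_eq_true]
      intro i
      rw [← hz' i]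
      exact (hQ _).2 _ fun j hj => hz1 _ (mem_slab.2 hj)
  | false =>
    obtain ⟨i, hi⟩ := andCopies_eq_false.1 hz
    refine ⟨(Q fun j => z (i, j)).map ⟨Prod.mk i, Prod.mk_right_injective i⟩, ?_,
      fun z' hz1 => ?_⟩
    · simpa [hi] using (hQ fun j => z (i, j)).1
    · rw [hz, andCopies_eq_false]
      refine ⟨i, ?_⟩
      rw [← hi]
      exact (hQ _).2 _ fun j hj => hz1 _ (by simpa using hj)

theorem HasUnambCert.andCopies {g : (ι → Bool) → Bool} {w : Bool → ℕ} (h : HasUnambCert g w) :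
    HasUnambCert (andCopies n g) (fun b => if b then n * w true else n * w true + w false) := by
  classical
  obtain ⟨Q, hQ⟩ := h
  let T (z : Fin n × ι → Bool) (i : Fin n) : Finset ι :=
    if ∀ i' < i, g (fun j => z (i', j)) = true then Q fun j => z (i, j) else ∅
  have hT {z i} (hi : ∀ i' < i, g (fun j => z (i', j)) = true) : T z i = Q fun j => z (i, j) :=
    if_pos hi
  have hT' {z i} (hi : ¬ ∀ i' < i, g (fun j => z (i', j)) = true) : T z i = ∅ := if_neg hi
  refine ⟨fun z => slab (T z), fun z => ⟨(card_slab_le _).trans ?_, fun z' hz' => ?_⟩⟩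
  · cases hz : _root_.andCopies n g z with
    | true =>
      have hz1 := andCopies_eq_true.1 hz
      refine (Finset.sum_le_card_nsmul _ _ (w true) fun i _ => ?_).trans (by simp)
      rw [hT fun i' _ => hz1 i']
      simpa [hz1 i] using (hQ fun j => z (i, j)).1
    | false =>
      have hex := andCopies_eq_false.1 hz
      obtain ⟨i₀, hi₀, hmin⟩ := WellFounded.has_min (wellFounded_lt (α := Fin n))
        {i | g (fun j => z (i, j)) = false} hex
      have hle : ∀ i ∈ Finset.univ, (T z i).card ≤ w true + if i = i₀ then w false else 0 := by
        intro i _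
        by_cases hi : ∀ i' < i, g (fun j => z (i', j)) = true
        · rw [hT hi]
          rcases lt_trichotomy i i₀ with hlt | heq | hgt
          · have hgi : g (fun j => z (i, j)) = true := by
              by_contra hne
              exact hmin i (by simpa using hne) hlt
            have hcard := (hQ fun j => z (i, j)).1
            rw [hgi] at hcard
            exact hcard.trans (Nat.le_add_right _ _)
          · have hcard := (hQ fun j => z (i, j)).1
            subst heq
            rw [show g (fun j => z (i, j)) = false from hi₀] at hcard
            rw [if_pos rfl]
            exact hcard.trans (Nat.le_add_left _ _)
          · have h1 := hi i₀ hgt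
            rw [show g (fun j => z (i₀, j)) = false from hi₀] at h1
            exact absurd h1 (by simp)
        · simp [hT' hi]
      refine (Finset.sum_le_sum hle).trans ?_
      simp [Finset.sum_add_distrib]
  · have key : ∀ i, (∀ i' < i, g (fun j => z (i', j)) = true) →
        g (fun j => z' (i, j)) = g (fun j => z (i, j)) ∧
          Q (fun j => z' (i, j)) = Q (fun j => z (i, j)) := by
      intro i hi
      refine (hQ _).2 _ fun j hj => hz' (i, j) (mem_slab.2 ?_)
      rwa [hT hi]
    have hpre : ∀ i, (∀ i' < i, g (fun j => z' (i', j)) = true) ↔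
        ∀ i' < i, g (fun j => z (i', j)) = true := by
      intro i
      constructor
      · intro H i' hi'
        induction i' using WellFoundedLT.induction with
        | ind i' ih =>
          rw [← (key i' fun l hl => ih l hl (hl.trans hi')).1]
          exact H i' hi'
      · intro H i' hi'
        rw [(key i' fun l hl => H l (hl.trans hi')).1]
        exact H i' hi'
    have hTT : T z' = T z := by
      funext i
      by_cases hi : ∀ i' < i, g (fun j => z (i', j)) = true
      · rw [hT hi, hT ((hpre i).2 hi), (key i hi).2]
      · rw [hT' hi, hT' (mt (hpre i).1 hi)]
    refine ⟨?_, by simp only [hTT]⟩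
    rw [Bool.eq_iff_iff, andCopies_eq_true, andCopies_eq_true]
    constructor
    · intro H i
      have hi := (hpre i).1 fun i' _ => H i'
      rw [← (key i hi).1]
      exact H i
    · intro H i
      rw [(key i fun i' _ => H i').1]
      exact H i

/-- The adversary can answer a query so that the value `true` stays possible. -/
theorem Hard.exists_query {g : (ι → Bool) → Bool} {A : Set (ι → Bool)} {d : ℕ}
    (h : Hard g A d) (ht : ∃ x ∈ A, g x = true) (j : ι) :
    ∃ b, Hard g {x ∈ A | x j = b} (d - 1) ∧ ∃ x ∈ {x ∈ A | x j = b}, g x = true := by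
  match d, h with
  | 0, _ | 1, _ =>
    obtain ⟨x, hx, hgx⟩ := ht
    exact ⟨x j, trivial, x, ⟨hx, rfl⟩, hgx⟩
  | d + 2, h =>
    obtain ⟨b, hb⟩ := h.2 j
    exact ⟨b, hb, hb.1 true⟩

theorem Hard.andCopies_pi {g : (ι → Bool) → Bool} {D : ℕ} (A : Fin n → Set (ι → Bool))
    (d : Fin n → ℕ) (h : ∀ i, Hard g (A i) (d i)) (ht : ∀ i, ∃ x ∈ A i, g x = true)
    (hD : D ≤ ∑ i, d i) :
    Hard (_root_.andCopies n g) {z | ∀ i, (fun j => z (i, j)) ∈ A i} D := by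
  classical
  induction D generalizing A d with
  | zero => trivial
  | succ D ih =>
    choose x hx hgx using ht
    refine ⟨fun b => ?_, fun ⟨i, j⟩ => ?_⟩
    · cases b with
      | true => exact ⟨fun p => x p.1 p.2, hx, andCopies_eq_true.2 hgx⟩
      | false =>
        obtain ⟨i, hi⟩ : ∃ i, d i ≠ 0 := by
          by_contra! H
          simp [H] at hD
        obtain ⟨e, he⟩ := Nat.exists_eq_succ_of_ne_zero hi
        have hi' := h i
        rw [he] at hi'
        obtain ⟨y, hy, hgy⟩ := hi'.1 false
        refine ⟨fun p => Function.update x i y p.1 p.2, fun l => ?_,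
          andCopies_eq_false.2 ⟨i, by simpa using hgy⟩⟩
        by_cases hl : l = i
        · subst hl; simpa using hy
        · simpa [hl] using hx l
    · obtain ⟨b, hb, hbt⟩ := (h i).exists_query ⟨x i, hx i, hgx i⟩ j
      refine ⟨b, (ih (Function.update A i {x ∈ A i | x j = b}) (Function.update d i (d i - 1))
        (fun l => ?_) (fun l => ?_) ?_).mono fun z hz => ⟨fun l => ?_, ?_⟩⟩
      · by_cases hl : l = i
        · subst hl; simpa using hb
        · simpa [hl] using h l
      · by_cases hl : l = i
        · subst hl; simpa using hbt
        · simpa [hl] using ⟨x l, hx l, hgx l⟩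
      · rw [Finset.sum_update_of_mem (Finset.mem_univ i)]
        rw [← Finset.add_sum_erase _ _ (Finset.mem_univ i), Finset.erase_eq] at hD
        omega
      · have := hz l
        by_cases hl : l = i
        · subst hl; simp at this; exact this.1
        · simpa [hl] using this
      · have := hz i
        simp at this
        exact this.2

theorem Hard.andCopies {g : (ι → Bool) → Bool} {d : ℕ} (h : Hard g Set.univ d)
    (hd : d ≠ 0) : Hard (andCopies n g) Set.univ (n * d) := by
  obtain ⟨e, rfl⟩ := Nat.exists_eq_succ_of_ne_zero hd
  exact (Hard.andCopies_pi (fun _ => Set.univ) (fun _ => e + 1) (fun _ => h)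
    (fun _ => h.1 true) (by simp)).mono (Set.subset_univ _)

end Conjunction

/-! ### Cheat sheets -/

section CheatSheet

variable {ι κ : Type} {c : ℕ}

/-- The index type of a cheat sheet function: `c` inputs, and one cell for each vector of
`c` values. -/
abbrev SheetIndex (c : ℕ) (ι κ : Type) : Type := (Fin c × ι) ⊕ ((Fin c → Bool) × κ)

/-- The values of the `c` inputs. -/
def sheetVals (f : (ι → Bool) → Bool) (z : SheetIndex c ι κ → Bool) : Fin c → Bool :=
  fun j => f fun i => z (.inl (j, i))

/-- The query sets stored in the cell addressed by the values of the inputs; `P` decodes cells. -/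
def sheetSets (f : (ι → Bool) → Bool) (P : (κ → Bool) → Fin c → Finset ι)
    (z : SheetIndex c ι κ → Bool) : Fin c → Finset ι :=
  P fun a => z (.inr (sheetVals f z, a))

open Classical in
/-- The cheat sheet function: accept if the addressed cell stores certificates of all inputs. -/
noncomputable def sheetFun (f : (ι → Bool) → Bool) (P : (κ → Bool) → Fin c → Finset ι)
    (z : SheetIndex c ι κ → Bool) : Bool :=
  decide (∀ j, Fixes f (sheetSets f P z j) fun i => z (.inl (j, i)))

/-- Query the addressed cell, and the sets `T j` in the inputs. -/
def sheetQuery [Fintype κ] [DecidableEq ι] (f : (ι → Bool) → Bool) (T : Fin c → Finset ι)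
    (z : SheetIndex c ι κ → Bool) : Finset (SheetIndex c ι κ) :=
  (slab T).disjSum (Finset.univ.map ⟨Prod.mk (sheetVals f z), Prod.mk_right_injective _⟩)

theorem sheet_congr [Fintype κ] [DecidableEq ι] {f : (ι → Bool) → Bool}
    {P : (κ → Bool) → Fin c → Finset ι} {T : Fin c → Finset ι} {z z' : SheetIndex c ι κ → Bool}
    (hT : ∀ j, Fixes f (T j) fun i => z (.inl (j, i))) (hPT : ∀ j, sheetSets f P z j ⊆ T j)
    (h : ∀ q ∈ sheetQuery f T z, z' q = z q) :
    sheetVals f z' = sheetVals f z ∧ sheetSets f P z' = sheetSets f P z ∧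
      sheetFun f P z' = sheetFun f P z := by
  have hl : ∀ j, ∀ i ∈ T j, z' (.inl (j, i)) = z (.inl (j, i)) := fun j i hi =>
    h _ (by simpa [sheetQuery] using mem_slab.2 hi)
  have hv : sheetVals f z' = sheetVals f z := funext fun j => hT j _ (hl j)
  have hs : sheetSets f P z' = sheetSets f P z := by
    unfold sheetSets
    rw [hv]
    congr 1
    funext a
    exact h _ (by simp [sheetQuery])
  refine ⟨hv, hs, ?_⟩
  unfold sheetFun
  rw [hs]
  congr 1
  exact propext (forall_congr' fun j => fixes_congr fun i hi => hl j i (hPT j hi))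

theorem card_sheetQuery_le [Fintype κ] [DecidableEq ι] {f : (ι → Bool) → Bool}
    {T : Fin c → Finset ι} {z : SheetIndex c ι κ → Bool} {u : ℕ} (hT : ∀ j, (T j).card ≤ u) :
    (sheetQuery f T z).card ≤ c * u + Fintype.card κ := by
  rw [sheetQuery, Finset.card_disjSum]
  have : (slab T).card ≤ c * u :=
    (card_slab_le T).trans ((Finset.sum_le_card_nsmul _ _ u fun j _ => hT j).trans (by simp))
  simpa using this

theorem HasCert.sheetFun [Fintype κ] {f : (ι → Bool) → Bool} {P : (κ → Bool) → Fin c → Finset ι}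
    {w u : ℕ} (hP : ∀ y j, (P y j).card ≤ w) (h : HasCert f fun _ => u) :
    HasCert (sheetFun f P) fun _ => c * (w + u) + Fintype.card κ := by
  classical
  obtain ⟨Q, hQ⟩ := h
  refine ⟨fun z => sheetQuery f (fun j => sheetSets f P z j ∪ Q fun i => z (.inl (j, i))) z,
    fun z => ⟨card_sheetQuery_le fun j => ?_, fun z' hz' => ?_⟩⟩
  · exact (Finset.card_union_le _ _).trans (add_le_add (hP _ _) (hQ _).1)
  · exact (sheet_congr (fun j x hx => (hQ _).2 _ fun i hi => hx i (Finset.mem_union_right _ hi))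
      (fun j => Finset.subset_union_left) hz').2.2

theorem HasUnambCert.sheetFun [Fintype κ] {f : (ι → Bool) → Bool}
    {P : (κ → Bool) → Fin c → Finset ι} {w u : ℕ} (hP : ∀ y j, (P y j).card ≤ w)
    (h : HasUnambCert f fun _ => u) :
    HasUnambCert (sheetFun f P)
      fun b => (if b then c * w else c * (w + u)) + Fintype.card κ := by
  classical
  obtain ⟨Q, hQ⟩ := h
  let T (z : SheetIndex c ι κ → Bool) (j : Fin c) : Finset ι :=
    if _root_.sheetFun f P z then sheetSets f P z j
    else sheetSets f P z j ∪ Q fun i => z (.inl (j, i))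
  have hTt {z} (hz : _root_.sheetFun f P z = true) : T z = sheetSets f P z := by
    funext j; simp [T, hz]
  have hTf {z} (hz : _root_.sheetFun f P z = false) :
      T z = fun j => sheetSets f P z j ∪ Q fun i => z (.inl (j, i)) := by
    funext j; simp [T, hz]
  refine ⟨fun z => sheetQuery f (T z) z, fun z => ?_⟩
  cases hz : _root_.sheetFun f P z with
  | true =>
    have hfix : ∀ j, Fixes f (sheetSets f P z j) fun i => z (.inl (j, i)) := by
      simpa [_root_.sheetFun] using hz
    simp only [hTt hz]
    refine ⟨card_sheetQuery_le fun j => hP _ _, fun z' hz' => ?_⟩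
    obtain ⟨h1, h2, h3⟩ := sheet_congr (P := P) hfix (fun j => subset_rfl) hz'
    rw [hz] at h3
    refine ⟨h3, ?_⟩
    rw [hTt h3, h2]
    simp [sheetQuery, h1]
  | false =>
    simp only [hTf hz]
    refine ⟨card_sheetQuery_le fun j =>
      (Finset.card_union_le _ _).trans (add_le_add (hP _ _) (hQ _).1), fun z' hz' => ?_⟩
    obtain ⟨h1, h2, h3⟩ := sheet_congr (P := P)
      (fun j x hx => ((hQ _).2 _ fun i hi => hx i (Finset.mem_union_right _ hi)).1)
      (fun j => Finset.subset_union_left) hz'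
    rw [hz] at h3
    refine ⟨h3, ?_⟩
    have h4 : ∀ j, Q (fun i => z' (.inl (j, i))) = Q fun i => z (.inl (j, i)) := fun j =>
      ((hQ _).2 _ fun i hi => hz' _ (by simp [sheetQuery, mem_slab, hi])).2
    simp only [hTf h3, h2, h4]
    simp [sheetQuery, h1]

theorem Hard.sheetFun_pi {f : (ι → Bool) → Bool} {P : (κ → Bool) → Fin c → Finset ι} {w : ℕ}
    (hc : 0 < c) (hP : ∀ S : Fin c → Finset ι, (∀ j, (S j).card ≤ w) → ∃ y, P y = S)
    (hf : HasCert f fun _ => w) {d : ℕ} (A : Fin c → Set (ι → Bool))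
    (U : Finset (Fin c → Bool)) (h : ∀ j, Hard f (A j) d) (hU : U.card + d ≤ 2 ^ c) :
    Hard (sheetFun f P)
      {z | (∀ j, (fun i => z (.inl (j, i))) ∈ A j) ∧ ∀ v ∈ U, ∀ a, z (.inr (v, a)) = false} d := by
  classical
  obtain ⟨Q, hQ⟩ := hf
  induction d generalizing A U with
  | zero => trivial
  | succ d ih =>
    refine ⟨fun b => ?_, fun q => ?_⟩
    · obtain ⟨v, hv⟩ : ∃ v, v ∉ U := by
        by_contra! H
        rw [Finset.eq_univ_iff_forall.2 H] at hU
        simp at hU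
      choose x hx hfx using fun j => (h j).1 (v j)
      obtain ⟨y, hy⟩ := hP (fun j => if b then Q (x j) else ∅) fun j => by
        cases b
        · simp
        · simpa using (hQ (x j)).1
      let z : SheetIndex c ι κ → Bool :=
        Sum.elim (fun p => x p.1 p.2) fun p => if p.1 = v then y p.2 else false
      have hvals : sheetVals f z = v := funext hfx
      have hsets : sheetSets f P z = fun j => if b then Q (x j) else ∅ := by
        unfold sheetSets
        rw [hvals, ← hy]
        simp [z]
      refine ⟨z, ⟨hx, fun v' hv' a => ?_⟩, ?_⟩
      · have : v' ≠ v := fun hvv => hv (hvv ▸ hv')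
        simp [z, this]
      · cases b with
        | true =>
          simp only [sheetFun, hsets, decide_eq_true_eq]
          exact fun j => (hQ (x j)).2
        | false =>
          simp only [sheetFun, hsets, decide_eq_false_iff_not]
          intro H
          obtain ⟨x', -, hx'⟩ := (h ⟨0, hc⟩).1 (!v ⟨0, hc⟩)
          have := H ⟨0, hc⟩ x' (by simp)
          rw [hx', show f (fun i => z (.inl (⟨0, hc⟩, i))) = v ⟨0, hc⟩ from hfx _] at this
          simp at this
    · match q with
      | .inl (j, i) =>
        obtain ⟨b, hb⟩ := (h j).2 i
        refine ⟨b, (ih (Function.update A j {x ∈ A j | x i = b}) U (fun l => ?_)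
          (by omega)).mono fun z hz => ⟨⟨fun l => ?_, hz.2⟩, ?_⟩⟩
        · by_cases hl : l = j
          · subst hl; simpa using hb
          · simpa [hl] using (h l).of_succ
        · have := hz.1 l
          by_cases hl : l = j
          · subst hl; simp at this; exact this.1
          · simpa [hl] using this
        · have := hz.1 j
          simp at this
          exact this.2
      | .inr (v, a) =>
        refine ⟨false, (ih A (insert v U) (fun j => (h j).of_succ) ?_).mono fun z hz =>
          ⟨⟨hz.1, fun v' hv' => hz.2 v' (Finset.mem_insert_of_mem hv')⟩,
            hz.2 v (Finset.mem_insert_self _ _) a⟩⟩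
        have := Finset.card_insert_le v U
        omega

theorem Hard.sheetFun {f : (ι → Bool) → Bool} {P : (κ → Bool) → Fin c → Finset ι} {w d : ℕ}
    (hc : 0 < c) (hP : ∀ S : Fin c → Finset ι, (∀ j, (S j).card ≤ w) → ∃ y, P y = S)
    (hf : HasCert f fun _ => w) (h : Hard f Set.univ d) (hd : d ≤ 2 ^ c) :
    Hard (sheetFun f P) Set.univ d :=
  (Hard.sheetFun_pi hc hP hf (fun _ => Set.univ) ∅ (fun _ => h) (by simpa using hd)).mono
    (Set.subset_univ _)

/-- Vectors of `c` sets of size at most `w` can be encoded with `c * w * L` bits, where `L` bits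
suffice to name an element or nothing. -/
theorem exists_sets_decoder [Fintype ι] (c w L : ℕ) (hL : Fintype.card ι + 1 ≤ 2 ^ L) :
    ∃ P : (Fin c × Fin w × Fin L → Bool) → Fin c → Finset ι, (∀ y j, (P y j).card ≤ w) ∧
      ∀ S : Fin c → Finset ι, (∀ j, (S j).card ≤ w) → ∃ y, P y = S := by
  classical
  obtain ⟨e⟩ : Nonempty (Option ι ↪ (Fin L → Bool)) :=
    Function.Embedding.nonempty_of_card_le (by simpa using hL)
  let dec := Function.invFun e
  have hdec : ∀ o, dec (e o) = o := Function.leftInverse_invFun e.injective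
  refine ⟨fun y j => Finset.univ.biUnion fun t : Fin w =>
    (dec fun l => y (j, t, l)).toFinset, fun y j => ?_, fun S hS => ?_⟩
  · refine Finset.card_biUnion_le.trans
      ((Finset.sum_le_card_nsmul _ _ 1 fun t _ => ?_).trans (by simp))
    rw [Option.card_toFinset]
    cases dec fun l => y (j, t, l) <;> simp
  · refine ⟨fun p => e ((S p.1).toList[(p.2.1 : ℕ)]?) p.2.2, funext fun j => ?_⟩
    ext i
    simp only [hdec, Finset.mem_biUnion, Finset.mem_univ, true_and, Option.mem_toFinset,
      Option.mem_def]
    rw [← Finset.mem_toList, List.mem_iff_getElem?]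
    constructor
    · rintro ⟨t, ht⟩
      exact ⟨t, ht⟩
    · rintro ⟨t, ht⟩
      have hlt : t < (S j).toList.length := (List.getElem?_eq_some_iff.1 ht).1
      rw [Finset.length_toList] at hlt
      exact ⟨⟨t, hlt.trans_le (hS j)⟩, ht⟩

end CheatSheet

/-! ### The recursive construction -/

section Recursion

theorem exists_step {ι : Type} [Fintype ι] {h : (ι → Bool) → Bool} {n c L s d : ℕ} (hn : 0 < n)
    (hc : 0 < c) (hL : 0 < L) (hd : d ≠ 0) (hcd : n * d ≤ 2 ^ c)
    (hcard : n * Fintype.card ι + 1 ≤ 2 ^ L) (hC : HasCert h fun b => if b then s else n * s)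
    (hU : HasUnambCert h fun _ => n * s) (hH : Hard h Set.univ d) :
    ∃ (ι' : Type) (_ : Fintype ι') (h' : (ι' → Bool) → Bool),
      Fintype.card ι' = n * (c * (n * Fintype.card ι) + 2 ^ c * (c * (n * s) * L)) ∧
      HasCert h' (fun b => if b then 6 * c * (n * s) * L else n * (6 * c * (n * s) * L)) ∧
      HasUnambCert h' (fun _ => n * (6 * c * (n * s) * L)) ∧ Hard h' Set.univ (n * (n * d)) := by
  obtain ⟨P, hP, hP'⟩ := exists_sets_decoder (ι := Fin n × ι) c (n * s) L (by simpa using hcard)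
  have hcw : c * (n * s) ≤ c * (n * s) * L := Nat.le_mul_of_pos_right _ hL
  have hnw : c * (n * s) * L ≤ n * (c * (n * s) * L) := Nat.le_mul_of_pos_left _ hn
  have hncw : n * (c * (n * s)) ≤ n * (c * (n * s) * L) := Nat.mul_le_mul_left _ hcw
  have hcellcard : Fintype.card (Fin c × Fin (n * s) × Fin L) = c * (n * s) * L := by
    simp [mul_assoc]
  have hFC : HasCert (andCopies n h) fun _ => n * s := hC.andCopies.mono (by simp)
  have hFU : HasUnambCert (andCopies n h) fun _ => n * (n * s) + n * s :=
    hU.andCopies.mono (by simp)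
  have hGC := (hFC.sheetFun hP).andCopies (n := n) |>.not
  have hGU := (hFU.sheetFun hP).andCopies (n := n) |>.not
  have hFH : Hard (andCopies n h) Set.univ (n * d) := hH.andCopies hd
  have hGH := ((hFH.sheetFun hc hP' hFC hcd).andCopies (n := n)
    (Nat.mul_ne_zero hn.ne' hd)).not
  refine ⟨_, inferInstance, _, ?_, hGC.mono ?_, hGU.mono ?_, hGH⟩
  · simp [mul_assoc]
  · rintro (_ | _)
    · simp only [hcellcard, Bool.not_false, if_true, Bool.false_eq_true, if_false]
      refine Nat.mul_le_mul_left _ ?_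
      nlinarith
    · simp only [hcellcard, Bool.not_true, if_true, Bool.false_eq_true, if_false]
      nlinarith
  · rintro (_ | _)
    · simp only [hcellcard, Bool.not_false, if_true]
      nlinarith
    · simp only [hcellcard, Bool.not_true, if_true, Bool.false_eq_true, if_false]
      nlinarith

theorem exists_base (n : ℕ) (hn : 0 < n) :
    HasCert (fun z : Fin n × Unit → Bool => !andCopies n (fun x => x ()) z)
        (fun b => if b then 2 else n * 2) ∧
      HasUnambCert (fun z : Fin n × Unit → Bool => !andCopies n (fun x => x ()) z)
        (fun _ => n * 2) ∧
      Hard (fun z : Fin n × Unit → Bool => !andCopies n (fun x => x ()) z) Set.univ n := by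
  have hU : HasUnambCert (fun x : Unit → Bool => x ()) fun _ => 1 := by
    refine ⟨fun _ => {()}, fun x => ⟨by simp, fun x' hx' => ⟨hx' () (by simp), rfl⟩⟩⟩
  have hH : Hard (fun x : Unit → Bool => x ()) Set.univ 1 :=
    ⟨fun b => ⟨fun _ => b, trivial, rfl⟩, fun _ => ⟨true, trivial⟩⟩
  refine ⟨(hU.hasCert.andCopies (n := n)).not.mono ?_, (hU.andCopies (n := n)).not.mono ?_, ?_⟩
  · rintro (_ | _)
    · simp only [Bool.not_false, if_true, Bool.false_eq_true, if_false]
      omega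
    · simp
  · rintro (_ | _)
    · simp only [Bool.not_false, if_true]
      omega
    · simp only [Bool.not_true, Bool.false_eq_true, if_false]
      omega
  · simpa using (hH.andCopies (n := n) one_ne_zero).not

theorem exists_family (k : ℕ) :
    ∃ a : ℕ, 0 < a ∧ ∀ n : ℕ, 2 ≤ n →
      ∃ (ι : Type) (_ : Fintype ι) (h : (ι → Bool) → Bool),
        Fintype.card ι ≤ a * n ^ (25 ^ k) ∧
        HasCert h (fun b => if b then a * n ^ k * (Nat.log 2 n + 1) ^ (2 * k)
          else n * (a * n ^ k * (Nat.log 2 n + 1) ^ (2 * k))) ∧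
        HasUnambCert h (fun _ => n * (a * n ^ k * (Nat.log 2 n + 1) ^ (2 * k))) ∧
        Hard h Set.univ (n ^ (2 * k + 1)) := by
  induction k with
  | zero =>
    refine ⟨2, two_pos, fun n hn => ⟨Fin n × Unit, inferInstance,
      fun z => !andCopies n (fun x => x ()) z, ?_, ?_⟩⟩
    · simp [Nat.le_mul_of_pos_left]
    · simpa using exists_base n (by omega)
  | succ k ih =>
    obtain ⟨a, ha, H⟩ := ih
    set q := 25 ^ k with hq
    have hkq : k < q := Nat.lt_pow_self (by norm_num)
    obtain ⟨r, hr⟩ : ∃ r, r = q + 1 + a := ⟨_, rfl⟩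
    refine ⟨6 * (2 * k + 2) * r * a + (2 * k + 2) * a + 2 ^ (2 * k + 2) * (2 * k + 2) * a * r,
      by positivity, fun n hn => ?_⟩
    obtain ⟨ι, _, h, hcard, hC, hU, hH⟩ := H n hn
    obtain ⟨m, hm⟩ : ∃ m, m = Nat.log 2 n + 1 := ⟨_, rfl⟩
    rw [← hm] at hC hU ⊢
    have hnm : n + 1 ≤ 2 ^ m := hm ▸ Nat.lt_pow_succ_log_self (by norm_num) n
    have hmn : 2 ^ m ≤ 2 * n := by
      rw [hm, pow_succ, mul_comm]
      exact Nat.mul_le_mul_left _ (Nat.pow_log_le_self 2 (by omega))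
    have hmn' : m ≤ n := hm ▸ Nat.log_lt_self 2 (by omega)
    have hm0 : 0 < m := by omega
    have hc : n * n ^ (2 * k + 1) ≤ 2 ^ (m * (2 * k + 2)) := by
      rw [pow_mul, ← pow_succ']
      exact Nat.pow_le_pow_left (by omega) _
    have hc' : 2 ^ (m * (2 * k + 2)) ≤ 2 ^ (2 * k + 2) * n ^ (2 * k + 2) := by
      rw [pow_mul, ← mul_pow]
      exact Nat.pow_le_pow_left hmn _
    have hL : n * Fintype.card ι + 1 ≤ 2 ^ (m * r) := by
      have h1 : n ^ (q + 1) + 1 ≤ (2 ^ m) ^ (q + 1) := by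
        refine le_trans ?_ (Nat.pow_le_pow_left hnm _)
        exact Nat.pow_lt_pow_left (Nat.lt_succ_self n) (by omega)
      have h2 : a + 1 ≤ (2 ^ m) ^ a :=
        Nat.lt_pow_self (Nat.one_lt_two_pow hm0.ne')
      rw [hr, pow_mul, pow_add]
      have h3 := Nat.mul_le_mul h1 h2
      have h4 := Nat.mul_le_mul_left n hcard
      rw [pow_succ] at h3
      nlinarith
    obtain ⟨ι', _, h', hcard', hC', hU', hH'⟩ := exists_step (by omega)
      (Nat.mul_pos hm0 (by omega)) (Nat.mul_pos hm0 (by omega : 0 < r))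
      (pow_ne_zero _ (by omega)) hc hL hC hU hH
    have ht : 6 * (m * (2 * k + 2)) * (n * (a * n ^ k * m ^ (2 * k))) * (m * r) ≤
        (6 * (2 * k + 2) * r * a + (2 * k + 2) * a + 2 ^ (2 * k + 2) * (2 * k + 2) * a * r) *
          n ^ (k + 1) * m ^ (2 * (k + 1)) := by
      calc _ = (6 * (2 * k + 2) * r * a) * n ^ (k + 1) * m ^ (2 * (k + 1)) := by ring
        _ ≤ _ := by
          gcongr
          omega
    refine ⟨ι', inferInstance, h', ?_, hC'.mono ?_, hU'.mono ?_, ?_⟩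
    · rw [hcard']
      have h25 : 25 ^ (k + 1) = 25 * q := by rw [hq, pow_succ, mul_comm]
      rw [h25]
      have hn1 : 1 ≤ n := by omega
      have e1 : n ^ (q + 3) ≤ n ^ (25 * q) := Nat.pow_le_pow_right hn1 (by omega)
      have e2 : n ^ (5 * k + 6) ≤ n ^ (25 * q) := Nat.pow_le_pow_right hn1 (by omega)
      calc _ ≤ n * (n * (2 * k + 2) * (n * (a * n ^ q)) +
            2 ^ (2 * k + 2) * n ^ (2 * k + 2) *
              (n * (2 * k + 2) * (n * (a * n ^ k * n ^ (2 * k))) * (n * r))) := by gcongr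
        _ = (2 * k + 2) * a * n ^ (q + 3) +
            2 ^ (2 * k + 2) * (2 * k + 2) * a * r * n ^ (5 * k + 6) := by ring
        _ ≤ (2 * k + 2) * a * n ^ (25 * q) +
            2 ^ (2 * k + 2) * (2 * k + 2) * a * r * n ^ (25 * q) := by gcongr
        _ ≤ _ := by
          rw [← add_mul, add_assoc]
          exact Nat.mul_le_mul_right _ (Nat.le_add_left _ _)
    · rintro (_ | _)
      · simpa using Nat.mul_le_mul_left n ht
      · simpa using ht
    · exact fun _ => Nat.mul_le_mul_left n ht
    · convert hH' using 1
      ring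

end Recursion

/-! ### Bounds for functions on `Fin N` -/

section Transfer

variable {ι ι' : Type}

theorem HasUnambCert.comp_equiv {f : (ι → Bool) → Bool} {w : Bool → ℕ} (h : HasUnambCert f w)
    (e : ι ≃ ι') : HasUnambCert (fun z : ι' → Bool => f (z ∘ e)) w := by
  obtain ⟨Q, hQ⟩ := h
  refine ⟨fun z => (Q (z ∘ e)).map e.toEmbedding, fun z => ⟨by simpa using (hQ _).1,
    fun z' hz' => ?_⟩⟩
  obtain ⟨h1, h2⟩ := (hQ (z ∘ e)).2 (z' ∘ e) fun i hi => hz' (e i) (by simpa using hi)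
  exact ⟨h1, by simp only [h2]⟩

theorem Hard.comp_equiv {f : (ι → Bool) → Bool} {A : Set (ι → Bool)} {d : ℕ} (h : Hard f A d)
    (e : ι ≃ ι') : Hard (fun z : ι' → Bool => f (z ∘ e)) {z | z ∘ e ∈ A} d := by
  induction d generalizing A with
  | zero => trivial
  | succ d ih =>
    refine ⟨fun b => ?_, fun i => ?_⟩
    · obtain ⟨x, hx, hb⟩ := h.1 b
      have hxe : (x ∘ e.symm) ∘ e = x := by
        funext i
        simp
      exact ⟨x ∘ e.symm, by simpa [hxe] using hx, by simpa [hxe] using hb⟩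
    · obtain ⟨b, hb⟩ := h.2 (e.symm i)
      refine ⟨b, (ih hb).mono fun z hz => ⟨hz.1, by simpa using hz.2⟩⟩

variable {N : ℕ} {f : (Fin N → Bool) → Bool}

theorem Hard.le_depth {A : Set (Fin N → Bool)} {d : ℕ} (h : Hard f A d) (T : DT N)
    (hT : ∀ x ∈ A, T.eval x = f x) : d ≤ T.depth := by
  induction T generalizing A d with
  | leaf b =>
    cases d with
    | zero => exact le_rfl
    | succ d =>
      obtain ⟨x, hx, hfx⟩ := h.1 (!b)
      have := hT x hx
      rw [hfx] at this
      simp [DT.eval] at this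
  | node i t0 t1 ih0 ih1 =>
    cases d with
    | zero => exact Nat.zero_le _
    | succ d =>
      obtain ⟨b, hb⟩ := h.2 i
      cases b with
      | false =>
        have := ih0 hb fun x hx => by simpa [DT.eval, hx.2] using hT x hx.1
        simp only [DT.depth]
        omega
      | true =>
        have := ih1 hb fun x hx => by simpa [DT.eval, hx.2] using hT x hx.1
        simp only [DT.depth]
        omega

/-- The tree that queries the variables in `l` in order, given the answers `x` so far. -/
def queryTree (f : (Fin N → Bool) → Bool) : List (Fin N) → (Fin N → Bool) → DT N
  | [], x => .leaf (f x)
  | i :: l, x => .node i (queryTree f l (Function.update x i false))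
      (queryTree f l (Function.update x i true))

theorem queryTree_eval (l : List (Fin N)) (x z : Fin N → Bool) (h : ∀ i ∉ l, x i = z i) :
    (queryTree f l x).eval z = f z := by
  induction l generalizing x with
  | nil => simp [queryTree, DT.eval, show x = z from funext fun i => h i (by simp)]
  | cons i l ih =>
    have key : (queryTree f l (Function.update x i (z i))).eval z = f z := by
      refine ih _ fun j hj => ?_
      by_cases hji : j = i
      · subst hji; simp
      · simpa [hji] using h j (by simp [hji, hj])
    cases hz : z i <;> simpa [queryTree, DT.eval, hz] using key

theorem Hard.le_Dquery {d : ℕ} (h : Hard f Set.univ d) : d ≤ Dquery f := by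
  refine le_csInf ?_ ?_
  · let T := queryTree f (List.finRange N) fun _ => false
    exact ⟨T.depth, T, le_rfl, fun z => queryTree_eval _ _ z (by simp)⟩
  · rintro b ⟨T, hTb, hT⟩
    exact (h.le_depth T fun x _ => hT x).trans hTb

theorem HasUnambCert.UCb_le {w : Bool → ℕ} (h : HasUnambCert f w) (b : Bool) :
    UCb f b ≤ w b := by
  classical
  obtain ⟨Q, hQ⟩ := h
  let p (z : Fin N → Bool) (i : Fin N) : Option Bool := if i ∈ Q z then some (z i) else none
  have hp : ∀ z x, Consistent x (p z) ↔ ∀ i ∈ Q z, x i = z i := by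
    intro z x
    simp only [Consistent, p]
    constructor
    · intro H i hi
      exact H i (z i) (by simp [hi])
    · intro H i c hc
      split_ifs at hc with hi
      · rw [H i hi]
        simpa using hc
  refine Nat.sInf_le ⟨{q | ∃ z, f z = b ∧ q = p z}, ?_, fun x hx => ⟨p x, ⟨⟨x, hx, rfl⟩,
    (hp x x).2 fun _ _ => rfl⟩, ?_⟩⟩
  · rintro _ ⟨z, rfl, rfl⟩
    refine ⟨fun x hx => ((hQ z).2 x ((hp z x).1 hx)).1, ?_⟩
    refine le_trans (Finset.card_le_card fun i hi => ?_) (hQ z).1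
    by_contra hiQ
    simp [p, hiQ] at hi
  · rintro _ ⟨⟨z, hz, rfl⟩, hxz⟩
    have hag := (hp z x).1 hxz
    have hQx := ((hQ z).2 x hag).2
    funext i
    by_cases hi : i ∈ Q z
    · simp [p, hQx, hi, hag i hi]
    · simp [p, hQx, hi]

theorem HasUnambCert.UC_le {w : ℕ} (h : HasUnambCert f fun _ => w) : UC f ≤ w :=
  max_le (h.UCb_le false) (h.UCb_le true)

end Transfer

theorem stmt4 (k : ℕ) :
    ∃ (a : ℝ) (d : ℕ), 0 < a ∧ 0 < d ∧ ∀ n : ℕ, 2 ≤ n →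
      ∃ (N : ℕ) (f : (Fin N → Bool) → Bool),
        (N : ℝ) ≤ a * (n : ℝ) ^ (25 ^ k) ∧
        (n : ℝ) ^ (2 * k + 1) / (a * Real.logb 2 n ^ d) ≤ (Dquery f : ℝ) ∧
        (UC f : ℝ) ≤ a * (n : ℝ) ^ (k + 1) * Real.logb 2 n ^ d := by
  obtain ⟨a, ha, H⟩ := exists_family k
  have ha1 : (1 : ℝ) ≤ a := by exact_mod_cast ha
  have hpow : (1 : ℝ) ≤ 2 ^ (2 * k) := one_le_pow₀ (by norm_num)
  have haa : (a : ℝ) ≤ a * 2 ^ (2 * k) := le_mul_of_one_le_right (by positivity) hpow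
  refine ⟨a * 2 ^ (2 * k), 2 * k + 1, by positivity, by omega, fun n hn => ?_⟩
  obtain ⟨ι, _, h, hcard, -, hU, hH⟩ := H n hn
  have hn2 : (2 : ℝ) ≤ n := by exact_mod_cast hn
  have hlog : 1 ≤ Real.logb 2 n := by
    rw [Real.le_logb_iff_rpow_le (by norm_num) (by positivity)]
    simpa using hn2
  have hlogn : ((Nat.log 2 n : ℕ) : ℝ) ≤ Real.logb 2 n := by
    exact_mod_cast Real.natLog_le_logb n 2
  let e := Fintype.equivFin ι
  refine ⟨Fintype.card ι, fun z => h (z ∘ e), ?_, ?_, ?_⟩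
  · calc (Fintype.card ι : ℝ) ≤ a * (n : ℝ) ^ (25 ^ k) := by exact_mod_cast hcard
      _ ≤ _ := by gcongr
  · have hD : n ^ (2 * k + 1) ≤ Dquery fun z => h (z ∘ e) :=
      ((hH.comp_equiv e).mono (Set.subset_univ _)).le_Dquery
    have hden : 1 ≤ (a * 2 ^ (2 * k) : ℝ) * Real.logb 2 n ^ (2 * k + 1) :=
      one_le_mul_of_one_le_of_one_le (ha1.trans haa) (one_le_pow₀ hlog)
    exact (div_le_self (by positivity) hden).trans (by exact_mod_cast hD)
  · have hUC := (hU.comp_equiv e).UC_le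
    calc (UC (fun z => h (z ∘ e)) : ℝ)
        ≤ n * (a * (n : ℝ) ^ k * (Nat.log 2 n + 1) ^ (2 * k)) := by exact_mod_cast hUC
      _ ≤ n * (a * (n : ℝ) ^ k * (2 * Real.logb 2 n) ^ (2 * k)) := by
        gcongr
        linarith
      _ = a * 2 ^ (2 * k) * (n : ℝ) ^ (k + 1) * Real.logb 2 n ^ (2 * k) := by ring
      _ ≤ _ := by
        gcongr
        omega
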